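/- Theorem 2.3, discrete-time part (quenched CLT for the step-reinforced Lévy–Lorentz gas): for every 0 ≤ p < 3/4, as n → ∞, X^{(p)}_n/√n converges in distribution to a centered Gaussian random variable with variance ℓ²(3 − 4p)^{−1}. -/

import Mathlib

open MeasureTheory ProbabilityTheory Filter Set Topology

theorem tendsto_zero_of_harmonic_contraction {q ε : ℕ → ℝ} {δ : ℝ} (hδ : 0 < δ)
    (hq : ∀ n, 0 ≤ q n) (hε : Tendsto ε atTop (𝓝 0))
    (h : ∀ᶠ n : ℕ in atTop, q (n + 1) ≤ (1 - δ / (n + 1)) * q n + ε n / (n + 1)) :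
    Tendsto q atTop (𝓝 0) := by
  rw [Metric.tendsto_atTop']
  intro η hη
  have hε' : ∀ᶠ n in atTop, ε n < δ * (η / 2) := hε.eventually_lt_const (by positivity)
  have hδn : ∀ᶠ n : ℕ in atTop, δ ≤ (n : ℝ) :=
    tendsto_natCast_atTop_atTop.eventually_ge_atTop δ
  obtain ⟨M, hM⟩ := eventually_atTop.1 (h.and (hε'.and hδn))
  set H : ℕ → ℝ := fun n => ∑ i ∈ Finset.range n, 1 / ((i : ℝ) + 1) with hH
  have hHsucc : ∀ n, H (n + 1) = H n + 1 / ((n : ℝ) + 1) := fun n => Finset.sum_range_succ _ _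
  have key : ∀ n, M ≤ n → q n ≤ η / 2 + q M * Real.exp (-δ * (H n - H M)) := by
    intro n hn
    induction n, hn using Nat.le_induction with
    | base => simp; positivity
    | succ n hn ih =>
      obtain ⟨h1, h2, h3⟩ := hM n hn
      have hn0 : (0 : ℝ) < n + 1 := by positivity
      have h4 : 0 ≤ 1 - δ / ((n : ℝ) + 1) := by
        rw [sub_nonneg, div_le_one hn0]; linarith
      have h5 : 1 - δ / ((n : ℝ) + 1) ≤ Real.exp (-(δ / ((n : ℝ) + 1))) := by
        have := Real.add_one_le_exp (-(δ / ((n : ℝ) + 1))); linarith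
      have h6 : Real.exp (-δ * (H (n + 1) - H M))
          = Real.exp (-(δ / ((n : ℝ) + 1))) * Real.exp (-δ * (H n - H M)) := by
        rw [← Real.exp_add, hHsucc]; congr 1; ring
      have h7 : ε n / (n + 1) ≤ δ / (n + 1) * (η / 2) := by
        rw [div_mul_eq_mul_div]; gcongr
      rw [h6]
      have h8 := mul_le_mul_of_nonneg_left ih h4
      have h9 : 0 ≤ q M * Real.exp (-δ * (H n - H M)) := mul_nonneg (hq M) (Real.exp_pos _).le
      have h10 := mul_le_mul_of_nonneg_right h5 h9
      nlinarith
  have hlim : Tendsto (fun n => q M * Real.exp (-δ * (H n - H M))) atTop (𝓝 0) := by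
    have h1 : Tendsto (fun n => H n - H M) atTop atTop :=
      tendsto_atTop_add_const_right _ _ Real.tendsto_sum_range_one_div_nat_succ_atTop
    have h2 := h1.const_mul_atTop_of_neg (neg_lt_zero.2 hδ)
    simpa using (Real.tendsto_exp_atBot.comp h2).const_mul (q M)
  obtain ⟨M', hM'⟩ := eventually_atTop.1 (hlim.eventually_lt_const (half_pos hη))
  refine ⟨max M M', fun n hn => ?_⟩
  rw [Real.dist_eq, sub_zero, abs_of_nonneg (hq n)]
  have h1 := key n (le_of_lt (lt_of_le_of_lt (le_max_left _ _) hn))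
  have h2 := hM' n (le_of_lt (lt_of_le_of_lt (le_max_right _ _) hn))
  linarith

theorem eventually_sq_one_add_div_mul_le {c : ℝ} (hc : c < 1 / 2) :
    ∀ᶠ n : ℕ in atTop, 0 < (n : ℝ) ∧ (1 - 2 * c) / 2 ≤ (n : ℝ) + 1 ∧
      (1 + c / n) ^ 2 * n ≤ (1 - (1 - 2 * c) / 2 / (n + 1)) * (n + 1) := by
  have hd : 0 < (1 - 2 * c) / 2 := by linarith
  filter_upwards [tendsto_natCast_atTop_atTop.eventually_ge_atTop (c ^ 2 / ((1 - 2 * c) / 2)),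
    tendsto_natCast_atTop_atTop.eventually_ge_atTop ((1 - 2 * c) / 2),
    tendsto_natCast_atTop_atTop.eventually_gt_atTop (0 : ℝ)] with n h1 h2 h3
  refine ⟨h3, by linarith, ?_⟩
  rw [div_le_iff₀ hd] at h1
  have h4 : c ^ 2 / n ≤ (1 - 2 * c) / 2 := by rw [div_le_iff₀ h3]; linarith
  have e1 : (1 + c / n) ^ 2 * n = n + 2 * c + c ^ 2 / n := by field_simp; ring
  have e2 : (1 - (1 - 2 * c) / 2 / ((n : ℝ) + 1)) * (n + 1) = n + 1 - (1 - 2 * c) / 2 := by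
    field_simp
  rw [e1, e2]; linarith

theorem tendsto_div_of_sq_recursion {c : ℝ} (hc : c < 1 / 2) {y ε : ℕ → ℝ} (hy : ∀ n, 0 ≤ y n)
    (hε : Tendsto ε atTop (𝓝 0)) (h : ∀ n : ℕ, y (n + 1) ≤ (1 + c / n) ^ 2 * y n + ε n) :
    Tendsto (fun n : ℕ => y n / n) atTop (𝓝 0) := by
  refine tendsto_zero_of_harmonic_contraction (δ := (1 - 2 * c) / 2) (by linarith)
    (fun n => div_nonneg (hy n) n.cast_nonneg) hε ?_
  filter_upwards [eventually_sq_one_add_div_mul_le hc] with n ⟨hn, _, h1⟩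
  have hn1 : (0 : ℝ) < n + 1 := by positivity
  push_cast
  rw [div_le_iff₀ hn1]
  have h2 : y n = n * (y n / n) := by field_simp
  have h3 := mul_le_mul_of_nonneg_right h1 (div_nonneg (hy n) hn.le)
  have e : (ε n / (n + 1)) * ((n : ℝ) + 1) = ε n := by field_simp
  calc y (n + 1) ≤ (1 + c / n) ^ 2 * y n + ε n := h n
    _ = (1 + c / n) ^ 2 * n * (y n / n) + ε n := by rw [mul_assoc, ← h2]
    _ ≤ _ := by rw [add_mul, e]; linarith

theorem tendsto_div_sq_of_pow_four_recursion {c : ℝ} (hc : c < 1 / 2) {z : ℕ → ℝ}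
    (hz : ∀ n, 0 ≤ z n) (h : ∀ n : ℕ, z (n + 1) ≤ (1 + c / n) ^ 4 * z n + 1) :
    Tendsto (fun n : ℕ => z n / (n : ℝ) ^ 2) atTop (𝓝 0) := by
  refine tendsto_zero_of_harmonic_contraction (δ := (1 - 2 * c) / 2) (by linarith)
    (fun n => div_nonneg (hz n) (by positivity)) tendsto_one_div_add_atTop_nhds_zero_nat ?_
  filter_upwards [eventually_sq_one_add_div_mul_le hc] with n ⟨hn, hd, h1⟩
  have hn1 : (0 : ℝ) < n + 1 := by positivity
  push_cast
  rw [div_le_iff₀ (by positivity)]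
  have h2 : z n = (n : ℝ) ^ 2 * (z n / (n : ℝ) ^ 2) := by field_simp
  set r := 1 - (1 - 2 * c) / 2 / ((n : ℝ) + 1) with hr
  have hr0 : 0 ≤ r := by rw [hr, sub_nonneg, div_le_one hn1]; exact hd
  have hr1 : r ≤ 1 := by
    have : 0 ≤ (1 - 2 * c) / 2 / ((n : ℝ) + 1) := div_nonneg (by linarith) hn1.le
    linarith
  have h3 : (1 + c / n) ^ 4 * (n : ℝ) ^ 2 ≤ r * (n + 1) ^ 2 := by
    calc (1 + c / n) ^ 4 * (n : ℝ) ^ 2 = ((1 + c / n) ^ 2 * n) ^ 2 := by ring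
      _ ≤ (r * (n + 1)) ^ 2 := by gcongr
      _ = r * (r * (n + 1) ^ 2) := by ring
      _ ≤ r * (1 * (n + 1) ^ 2) := by gcongr
      _ = _ := by ring
  have h4 := mul_le_mul_of_nonneg_right h3 (div_nonneg (hz n) (sq_nonneg (n : ℝ)))
  have e : (1 / ((n : ℝ) + 1) / (n + 1)) * ((n : ℝ) + 1) ^ 2 = 1 := by field_simp
  calc z (n + 1) ≤ (1 + c / n) ^ 4 * z n + 1 := h n
    _ = (1 + c / n) ^ 4 * (n : ℝ) ^ 2 * (z n / (n : ℝ) ^ 2) + 1 := by rw [mul_assoc, ← h2]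
    _ ≤ _ := by rw [add_mul, e]; linarith

/-- Solution of `u 0 = 0`, `u (n + 1) = (1 + c / n) ^ k * u n + b n`. -/
noncomputable def affineRec (c : ℝ) (k : ℕ) (b : ℕ → ℝ) : ℕ → ℝ
  | 0 => 0
  | n + 1 => (1 + c / n) ^ k * affineRec c k b n + b n

theorem affineRec_nonneg (c : ℝ) {k : ℕ} (hk : Even k) {b : ℕ → ℝ} (hb : ∀ n, 0 ≤ b n) (n : ℕ) :
    0 ≤ affineRec c k b n := by
  induction n with
  | zero => exact le_rfl
  | succ n ih => exact add_nonneg (mul_nonneg (hk.pow_nonneg _) ih) (hb n)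

theorem tendsto_affineRec_one_div {c : ℝ} (hc : c < 1 / 2) :
    Tendsto (fun n : ℕ => affineRec c 2 (fun _ => 1) n / n) atTop (𝓝 (1 - 2 * c)⁻¹) := by
  set L := (1 - 2 * c)⁻¹ with hL
  have hL' : L * (1 - 2 * c) = 1 := inv_mul_cancel₀ (by linarith)
  set v := affineRec c 2 (fun _ => 1) with hv
  have hv1 : ∀ n : ℕ, v (n + 1) = (1 + c / n) ^ 2 * v n + 1 := fun n => rfl
  have hd : Tendsto (fun n : ℕ => |v n - L * n| / n) atTop (𝓝 0) := by
    refine tendsto_div_of_sq_recursion hc (fun n => abs_nonneg _)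
      (ε := fun n : ℕ => |if n = 0 then 1 - L else L * c ^ 2 / n|) ?_ ?_
    · have h1 : Tendsto (fun n : ℕ => |L * c ^ 2 / (n : ℝ)|) atTop (𝓝 0) := by
        simpa using (tendsto_const_div_atTop_nhds_zero_nat (L * c ^ 2)).abs
      refine h1.congr' ?_
      filter_upwards [eventually_gt_atTop 0] with n hn
      rw [if_neg hn.ne']
    · intro n
      have : v (n + 1) - L * ((n + 1 : ℕ) : ℝ) = (1 + c / n) ^ 2 * (v n - L * n)
          + if n = 0 then 1 - L else L * c ^ 2 / n := by
        rw [hv1]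
        split_ifs with h0
        · subst h0; simp; ring
        · have : (n : ℝ) ≠ 0 := by exact_mod_cast h0
          push_cast
          field_simp
          linear_combination (-(n : ℝ) ^ 2) * hL'
      rw [this]
      refine (abs_add_le _ _).trans_eq ?_
      rw [abs_mul, abs_of_nonneg (sq_nonneg _)]
  have h2 : Tendsto (fun n : ℕ => (v n - L * n) / n) atTop (𝓝 0) := by
    refine (tendsto_zero_iff_abs_tendsto_zero _).2 (hd.congr fun n => ?_)
    simp [abs_div]
  refine (by simpa using h2.add_const L : Tendsto _ _ (𝓝 L)).congr' ?_
  filter_upwards [eventually_gt_atTop 0] with n hn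
  have : (n : ℝ) ≠ 0 := by exact_mod_cast hn.ne'
  field_simp; ring

theorem norm_cos_add_sin_sub_exp_le {θ u : ℝ} (hu : |u| ≤ 1) :
    ‖((Real.cos θ : ℂ) + (u * Real.sin θ : ℝ) * Complex.I)
      - Complex.exp ((θ * u : ℝ) * Complex.I) * (Real.exp (-(θ ^ 2 / 2)) : ℝ)‖
      ≤ 3 * (θ ^ 4 + θ ^ 2 * u ^ 2) := by
  set E := Real.exp (-(θ ^ 2 / 2)) with hE
  have hE0 : 0 < E := Real.exp_pos _
  have hE1 : E ≤ 1 := Real.exp_le_one_iff.2 (by nlinarith [sq_nonneg θ])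
  have hnE : ‖(E : ℂ)‖ = E := by rw [Complex.norm_real, Real.norm_of_nonneg hE0.le]
  rcases le_or_gt |θ| 1 with hθ | hθ
  · have hθ2 : θ ^ 2 ≤ 1 := by rw [← sq_abs]; nlinarith [abs_nonneg θ]
    have b1 : ‖((Real.cos θ - (1 - θ ^ 2 / 2) : ℝ) : ℂ)‖ ≤ θ ^ 4 := by
      rw [Complex.norm_real, Real.norm_eq_abs]
      refine (Real.cos_bound hθ).trans ?_
      rw [Even.pow_abs ⟨2, rfl⟩]
      nlinarith [sq_nonneg (θ ^ 2)]
    have b2 : ‖((1 - θ ^ 2 / 2 - E : ℝ) : ℂ)‖ ≤ θ ^ 4 / 4 := by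
      rw [Complex.norm_real, Real.norm_eq_abs, abs_sub_comm]
      have := Real.abs_exp_sub_one_sub_id_le (x := -(θ ^ 2 / 2))
        (by rw [abs_neg, abs_of_nonneg (by positivity)]; linarith)
      rw [← hE] at this
      calc |E - (1 - θ ^ 2 / 2)| = |E - 1 - -(θ ^ 2 / 2)| := by congr 1; ring
        _ ≤ _ := this
        _ = _ := by ring
    have hcross : |u| * |θ| ^ 3 ≤ (θ ^ 2 * u ^ 2 + θ ^ 4) / 2 := by
      have h1 : θ ^ 4 = |θ| ^ 4 := (Even.pow_abs ⟨2, rfl⟩ θ).symm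
      rw [h1, ← sq_abs θ, ← sq_abs u]
      nlinarith [sq_nonneg (|θ| * |u| - |θ| ^ 2)]
    have b3 : ‖((u * (Real.sin θ - θ) : ℝ) : ℂ) * Complex.I‖ ≤ |u| * |θ| ^ 3 := by
      rw [norm_mul, Complex.norm_I, mul_one, Complex.norm_real, Real.norm_eq_abs, abs_mul]
      gcongr
      have h1 : |Real.sin θ - θ| ≤ |Real.sin θ - (θ - θ ^ 3 / 6)| + |θ ^ 3 / 6| := by
        calc |Real.sin θ - θ| = |(Real.sin θ - (θ - θ ^ 3 / 6)) + -(θ ^ 3 / 6)| := by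
              congr 1; ring
          _ ≤ _ := by
            rw [← abs_neg (θ ^ 3 / 6)]; exact abs_add_le _ _
      have h2 : |θ ^ 3 / 6| = |θ| ^ 3 / 6 := by rw [abs_div, abs_pow]; norm_num
      have h3 : |θ| ^ 5 ≤ |θ| ^ 3 := pow_le_pow_of_le_one (abs_nonneg _) hθ (by norm_num)
      have h4 := Real.sin_bound hθ
      have h5 : 0 ≤ |θ| ^ 3 := by positivity
      linarith
    have b4 : ‖((u * θ * (1 - E) : ℝ) : ℂ) * Complex.I‖ ≤ |u| * |θ| ^ 3 / 2 := by
      rw [norm_mul, Complex.norm_I, mul_one, Complex.norm_real, Real.norm_eq_abs, abs_mul, abs_mul]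
      have h1 : |1 - E| ≤ |θ| ^ 2 / 2 := by
        rw [abs_of_nonneg (by linarith), sq_abs]
        have := Real.add_one_le_exp (-(θ ^ 2 / 2))
        linarith
      calc |u| * |θ| * |1 - E| ≤ |u| * |θ| * (|θ| ^ 2 / 2) := by gcongr
        _ = _ := by ring
    have b5 : ‖(E : ℂ) * (Complex.exp ((θ * u : ℝ) * Complex.I) - 1
        - (θ * u : ℝ) * Complex.I)‖ ≤ θ ^ 2 * u ^ 2 := by
      have h0 : ‖((θ * u : ℝ) : ℂ) * Complex.I‖ = |θ * u| := by
        rw [norm_mul, Complex.norm_I, mul_one, Complex.norm_real, Real.norm_eq_abs]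
      have h1 : |θ * u| ≤ 1 := by rw [abs_mul]; exact mul_le_one₀ hθ (abs_nonneg _) hu
      have h2 := Complex.norm_exp_sub_one_sub_id_le (h0.trans_le h1)
      rw [h0, sq_abs, mul_pow] at h2
      rw [norm_mul, hnE]
      calc E * _ ≤ 1 * (θ ^ 2 * u ^ 2) := by gcongr
        _ = _ := one_mul _
    have hsplit : ((Real.cos θ : ℂ) + (u * Real.sin θ : ℝ) * Complex.I)
        - Complex.exp ((θ * u : ℝ) * Complex.I) * (E : ℝ)
        = ((Real.cos θ - (1 - θ ^ 2 / 2) : ℝ) : ℂ) + ((1 - θ ^ 2 / 2 - E : ℝ) : ℂ)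
          + ((u * (Real.sin θ - θ) : ℝ) : ℂ) * Complex.I
          + ((u * θ * (1 - E) : ℝ) : ℂ) * Complex.I
          - (E : ℂ) * (Complex.exp ((θ * u : ℝ) * Complex.I) - 1
            - (θ * u : ℝ) * Complex.I) := by
      push_cast; ring
    rw [hsplit]
    refine (norm_sub_le _ _).trans ((add_le_add_left (norm_add₄_le) _).trans ?_)
    have : 0 ≤ θ ^ 4 := by positivity
    have : 0 ≤ θ ^ 2 * u ^ 2 := by positivity
    linarith
  · have h1 : ‖(Real.cos θ : ℂ)‖ ≤ 1 := by
      rw [Complex.norm_real]; exact Real.abs_cos_le_one θ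
    have h2 : ‖((u * Real.sin θ : ℝ) : ℂ) * Complex.I‖ ≤ 1 := by
      rw [norm_mul, Complex.norm_I, mul_one, Complex.norm_real, Real.norm_eq_abs, abs_mul]
      exact mul_le_one₀ hu (abs_nonneg _) (Real.abs_sin_le_one θ)
    have h3 : ‖Complex.exp ((θ * u : ℝ) * Complex.I) * (E : ℝ)‖ ≤ 1 := by
      rw [norm_mul, Complex.norm_exp_ofReal_mul_I, one_mul, hnE]; exact hE1
    have h4 : 1 ≤ θ ^ 4 := by
      rw [← Even.pow_abs ⟨2, rfl⟩ θ]; exact one_le_pow₀ hθ.le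
    have h5 : 0 ≤ θ ^ 2 * u ^ 2 := by positivity
    have h6 := norm_sub_le ((Real.cos θ : ℂ) + (u * Real.sin θ : ℝ) * Complex.I)
      (Complex.exp ((θ * u : ℝ) * Complex.I) * (E : ℝ))
    have h7 := norm_add_le (Real.cos θ : ℂ) ((u * Real.sin θ : ℝ) * Complex.I)
    linarith

/-- A nearest-neighbour walk from `0` whose step from time `n` to time `n + 1` has conditional mean
`c * S n / n`, through the one-step transition formula. At `n = 0` the mean is `c * 0 / 0 = 0`. -/
structure IsReinforcedWalk {Ω : Type*} [MeasurableSpace Ω] (μ : Measure Ω) (c : ℝ)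
    (S : ℕ → Ω → ℤ) : Prop where
  measurable : ∀ n, Measurable (S n)
  zero : ∀ a, S 0 a = 0
  abs_le : ∀ n a, |S n a| ≤ n
  integral_succ : ∀ (n : ℕ) (f : ℤ → ℂ), ∫ a, f (S (n + 1) a) ∂μ =
    ∫ a, ((1 + (c * S n a / n : ℝ)) / 2 * f (S n a + 1)
      + (1 - (c * S n a / n : ℝ)) / 2 * f (S n a - 1)) ∂μ

theorem integrable_comp_of_abs_le {Ω E : Type*} [MeasurableSpace Ω] [NormedAddCommGroup E]
    {μ : Measure Ω} [IsFiniteMeasure μ] {T : Ω → ℤ} (hT : Measurable T) {n : ℕ}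
    (hn : ∀ a, |T a| ≤ n) (f : ℤ → E) : Integrable (fun a => f (T a)) μ := by
  refine Integrable.of_bound (C := ∑ k ∈ Finset.Icc (-n : ℤ) n, ‖f k‖)
    ((StronglyMeasurable.of_discrete (f := f)).comp_measurable hT).aestronglyMeasurable
    (ae_of_all _ fun a => ?_)
  exact Finset.single_le_sum (f := fun k => ‖f k‖) (fun k _ => norm_nonneg _)
    (Finset.mem_Icc.2 (_root_.abs_le.1 (hn a)))

namespace IsReinforcedWalk

variable {Ω : Type*} [MeasurableSpace Ω] {μ : Measure Ω} {c : ℝ}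
  {S : ℕ → Ω → ℤ}

theorem abs_drift_le (h : IsReinforcedWalk μ c S) (hc : |c| ≤ 1) (n : ℕ) (a : Ω) :
    |c * S n a / n| ≤ 1 := by
  have h1 : |(S n a : ℝ)| ≤ n := by exact_mod_cast h.abs_le n a
  rw [abs_div, abs_mul, Nat.abs_cast]
  refine div_le_one_of_le₀ ?_ n.cast_nonneg
  calc |c| * |(S n a : ℝ)| ≤ 1 * n := by gcongr
    _ = n := one_mul _

/-- Mean square of the drift `c * S n / n`. -/
noncomputable def meanSqDrift (μ : Measure Ω) (c : ℝ) (S : ℕ → Ω → ℤ) (n : ℕ) : ℝ :=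
  ∫ a, (c * S n a / n : ℝ) ^ 2 ∂μ

theorem meanSqDrift_nonneg (n : ℕ) : 0 ≤ meanSqDrift μ c S n :=
  integral_nonneg fun _ => sq_nonneg _

variable [IsProbabilityMeasure μ]

theorem integrable_comp {E : Type*} [NormedAddCommGroup E] (h : IsReinforcedWalk μ c S) (n : ℕ)
    (f : ℤ → E) : Integrable (fun a => f (S n a)) μ :=
  integrable_comp_of_abs_le (h.measurable n) (h.abs_le n) f

theorem integral_sq_succ (h : IsReinforcedWalk μ c S) (n : ℕ) :
    ∫ a, (S (n + 1) a : ℝ) ^ 2 ∂μ = (1 + 2 * c / n) * ∫ a, (S n a : ℝ) ^ 2 ∂μ + 1 := by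
  have h1 := h.integral_succ n (fun k => (((k : ℝ) ^ 2 : ℝ) : ℂ))
  have h2 : ∀ a, (1 + (c * S n a / n : ℝ)) / 2 * ((((S n a + 1 : ℤ) : ℝ) ^ 2 : ℝ) : ℂ)
      + (1 - (c * S n a / n : ℝ)) / 2 * ((((S n a - 1 : ℤ) : ℝ) ^ 2 : ℝ) : ℂ)
      = (((1 + 2 * c / n) * (S n a : ℝ) ^ 2 + 1 : ℝ) : ℂ) := by
    intro a; push_cast; ring
  simp_rw [h2] at h1
  rw [integral_complex_ofReal, integral_complex_ofReal, Complex.ofReal_inj,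
    integral_add ((h.integrable_comp n fun k => (k : ℝ) ^ 2).const_mul _) (integrable_const _),
    integral_const_mul] at h1
  simpa using h1

theorem integral_sq_le (h : IsReinforcedWalk μ c S) (hc : c < 1 / 2) (n : ℕ) :
    ∫ a, (S n a : ℝ) ^ 2 ∂μ ≤ max 1 (1 - 2 * c)⁻¹ * n := by
  set K := max 1 (1 - 2 * c)⁻¹ with hK
  have hK1 : 1 ≤ K := le_max_left _ _
  have hK2 : 1 ≤ K * (1 - 2 * c) := by
    have : (1 - 2 * c)⁻¹ * (1 - 2 * c) = 1 := inv_mul_cancel₀ (by linarith)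
    refine this.symm.trans_le ?_
    exact mul_le_mul_of_nonneg_right (le_max_right _ _) (by linarith)
  induction n with
  | zero => simp [h.zero]
  | succ n ih =>
    rw [h.integral_sq_succ]
    have h0 : 0 ≤ ∫ a, (S n a : ℝ) ^ 2 ∂μ := integral_nonneg fun a => sq_nonneg _
    rcases Nat.eq_zero_or_pos n with rfl | hn
    · simp [h.zero]; exact hK1
    have hn' : (0 : ℝ) < n := by exact_mod_cast hn
    push_cast
    rcases le_or_gt c 0 with hc0 | hc0
    · have : 2 * c / n ≤ 0 := div_nonpos_of_nonpos_of_nonneg (by linarith) hn'.le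
      nlinarith
    · have h3 : 0 ≤ 1 + 2 * c / n := by positivity
      have h4 := mul_le_mul_of_nonneg_left ih h3
      have h5 : (1 + 2 * c / n) * (K * n) = K * n + 2 * c * K := by field_simp
      linarith

theorem tendsto_meanSqDrift (h : IsReinforcedWalk μ c S) (hc : c < 1 / 2) :
    Tendsto (meanSqDrift μ c S) atTop (𝓝 0) := by
  refine squeeze_zero meanSqDrift_nonneg (fun n => ?_)
    (tendsto_const_div_atTop_nhds_zero_nat (c ^ 2 * max 1 (1 - 2 * c)⁻¹))
  have h1 : ∀ a, (c * S n a / n : ℝ) ^ 2 = c ^ 2 / (n : ℝ) ^ 2 * (S n a : ℝ) ^ 2 := by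
    intro a; ring
  simp_rw [meanSqDrift, h1]
  rw [integral_const_mul]
  refine (mul_le_mul_of_nonneg_left (h.integral_sq_le hc n) (by positivity)).trans_eq ?_
  rcases Nat.eq_zero_or_pos n with rfl | hn
  · simp
  have hn' : (n : ℝ) ≠ 0 := by exact_mod_cast hn.ne'
  field_simp

theorem norm_charFun_succ_sub_le (h : IsReinforcedWalk μ c S) (hc : |c| ≤ 1) (n : ℕ) (θ : ℝ) :
    ‖∫ a, Complex.exp ((θ * S (n + 1) a : ℝ) * Complex.I) ∂μ
      - (Real.exp (-(θ ^ 2 / 2)) : ℝ)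
        * ∫ a, Complex.exp ((θ * (1 + c / n) * S n a : ℝ) * Complex.I) ∂μ‖
      ≤ 3 * (θ ^ 4 + θ ^ 2 * meanSqDrift μ c S n) := by
  have hstep : ∀ (s u : ℝ),
      (1 + (u : ℂ)) / 2 * Complex.exp ((θ * (s + 1) : ℝ) * Complex.I)
        + (1 - (u : ℂ)) / 2 * Complex.exp ((θ * (s - 1) : ℝ) * Complex.I)
      = Complex.exp ((θ * s : ℝ) * Complex.I)
        * ((Real.cos θ : ℂ) + (u * Real.sin θ : ℝ) * Complex.I) := by
    intro s u
    have e1 : ((θ * (s + 1) : ℝ) : ℂ) * Complex.I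
        = (θ * s : ℝ) * Complex.I + θ * Complex.I := by push_cast; ring
    have e2 : ((θ * (s - 1) : ℝ) : ℂ) * Complex.I
        = (θ * s : ℝ) * Complex.I + (-θ : ℝ) * Complex.I := by push_cast; ring
    rw [e1, e2, Complex.exp_add, Complex.exp_add, Complex.exp_mul_I θ, Complex.exp_mul_I (-θ : ℝ)]
    push_cast
    rw [Complex.cos_neg, Complex.sin_neg]
    ring
  have h1 := h.integral_succ n (fun k => Complex.exp ((θ * (k : ℝ) : ℝ) * Complex.I))
  simp only [Int.cast_add, Int.cast_sub, Int.cast_one] at h1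
  simp_rw [hstep] at h1
  rw [h1, ← integral_const_mul, ← integral_sub
    (h.integrable_comp n fun k => Complex.exp ((θ * (k : ℝ) : ℝ) * Complex.I)
      * ((Real.cos θ : ℂ) + (c * (k : ℝ) / n * Real.sin θ : ℝ) * Complex.I))
    (h.integrable_comp n fun k => (Real.exp (-(θ ^ 2 / 2)) : ℂ)
      * Complex.exp ((θ * (1 + c / n) * (k : ℝ) : ℝ) * Complex.I)),
    meanSqDrift, ← integral_const_mul (θ ^ 2)]
  have h2 : 3 * (θ ^ 4 + ∫ a, θ ^ 2 * (c * S n a / n : ℝ) ^ 2 ∂μ)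
      = ∫ a, 3 * (θ ^ 4 + θ ^ 2 * (c * S n a / n : ℝ) ^ 2) ∂μ := by
    rw [integral_const_mul 3, integral_add (integrable_const _)
      (h.integrable_comp n fun k => θ ^ 2 * (c * (k : ℝ) / n) ^ 2)]
    simp
  rw [h2]
  refine norm_integral_le_of_norm_le
    (h.integrable_comp n fun k => 3 * (θ ^ 4 + θ ^ 2 * (c * (k : ℝ) / n) ^ 2))
    (ae_of_all _ fun a => ?_)
  have h3 : ((θ * (1 + c / n) * S n a : ℝ) : ℂ) * Complex.I
      = (θ * S n a : ℝ) * Complex.I + (θ * (c * S n a / n) : ℝ) * Complex.I := by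
    push_cast; ring
  rw [h3, Complex.exp_add, mul_left_comm, ← mul_sub, norm_mul, Complex.norm_exp_ofReal_mul_I,
    one_mul, mul_comm ((Real.exp _ : ℝ) : ℂ)]
  exact norm_cos_add_sin_sub_exp_le (h.abs_drift_le hc n a)

theorem norm_charFun_sub_exp_le (h : IsReinforcedWalk μ c S) (hc : |c| ≤ 1) (n : ℕ) (θ : ℝ) :
    ‖∫ a, Complex.exp ((θ * S n a : ℝ) * Complex.I) ∂μ
      - (Real.exp (-(θ ^ 2 / 2 * affineRec c 2 (fun _ => 1) n)) : ℝ)‖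
      ≤ 3 * (θ ^ 4 * affineRec c 4 (fun _ => 1) n
        + θ ^ 2 * affineRec c 2 (meanSqDrift μ c S) n) := by
  induction n generalizing θ with
  | zero => simp [h.zero, affineRec]
  | succ n ih =>
    set E := Real.exp (-(θ ^ 2 / 2)) with hE
    have hE1 : ‖(E : ℂ)‖ ≤ 1 := by
      rw [Complex.norm_real, Real.norm_of_nonneg (Real.exp_pos _).le, Real.exp_le_one_iff]
      nlinarith [sq_nonneg θ]
    have hexp : Real.exp (-(θ ^ 2 / 2 * affineRec c 2 (fun _ => 1) (n + 1)))
        = E * Real.exp (-((θ * (1 + c / n)) ^ 2 / 2 * affineRec c 2 (fun _ => 1) n)) := by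
      rw [hE, ← Real.exp_add, affineRec]; congr 1; ring
    have h1 := h.norm_charFun_succ_sub_le hc n θ
    have h2 := ih (θ * (1 + c / n))
    rw [hexp, Complex.ofReal_mul]
    refine (norm_sub_le_norm_sub_add_norm_sub _
      ((E : ℂ) * ∫ a, Complex.exp ((θ * (1 + c / n) * S n a : ℝ) * Complex.I) ∂μ) _).trans ?_
    rw [← mul_sub, norm_mul]
    refine (add_le_add h1 ((mul_le_of_le_one_left (norm_nonneg _) hE1).trans h2)).trans_eq ?_
    simp only [affineRec]
    ring

theorem tendsto_charFun (h : IsReinforcedWalk μ c S) (hc1 : |c| ≤ 1) (hc : c < 1 / 2) (t : ℝ) :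
    Tendsto (fun n : ℕ => ∫ a, Complex.exp ((t / √n * S n a : ℝ) * Complex.I) ∂μ) atTop
      (𝓝 (Real.exp (-(t ^ 2 / 2 * (1 - 2 * c)⁻¹)) : ℝ)) := by
  have hpow : ∀ n : ℕ, (t / √n) ^ 2 = t ^ 2 / n := fun n => by
    rw [div_pow, Real.sq_sqrt n.cast_nonneg]
  have hpow4 : ∀ n : ℕ, (t / √n) ^ 4 = t ^ 4 / (n : ℝ) ^ 2 := fun n => by
    rw [show (t / √n) ^ 4 = ((t / √n) ^ 2) ^ 2 by ring, hpow]; ring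
  have h1 : Tendsto (fun n : ℕ => (((Real.exp (-((t / √n) ^ 2 / 2
      * affineRec c 2 (fun _ => 1) n)) : ℝ)) : ℂ)) atTop
      (𝓝 (Real.exp (-(t ^ 2 / 2 * (1 - 2 * c)⁻¹)) : ℝ)) := by
    refine (Complex.continuous_ofReal.tendsto _).comp ((Real.continuous_exp.tendsto _).comp ?_)
    refine (((tendsto_affineRec_one_div hc).const_mul (t ^ 2 / 2)).neg).congr fun n => ?_
    rw [hpow]; ring
  have h2 : Tendsto (fun n : ℕ => 3 * ((t / √n) ^ 4 * affineRec c 4 (fun _ => 1) n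
      + (t / √n) ^ 2 * affineRec c 2 (meanSqDrift μ c S) n)) atTop (𝓝 0) := by
    have hz := tendsto_div_sq_of_pow_four_recursion hc
      (affineRec_nonneg c (k := 4) ⟨2, rfl⟩ fun _ => zero_le_one) fun n => le_rfl
    have hy := tendsto_div_of_sq_recursion hc
      (affineRec_nonneg c (k := 2) ⟨1, rfl⟩ (meanSqDrift_nonneg (μ := μ) (c := c) (S := S)))
      (h.tendsto_meanSqDrift hc) fun n => le_rfl
    have := ((hz.const_mul (t ^ 4)).add (hy.const_mul (t ^ 2))).const_mul 3
    simp only [mul_zero, add_zero] at this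
    refine this.congr fun n => ?_
    rw [hpow, hpow4]; ring
  have h3 := squeeze_zero_norm (fun n : ℕ => h.norm_charFun_sub_exp_le hc1 n (t / √n)) h2
  simpa using h3.add h1

end IsReinforcedWalk

theorem exists_abs_sub_mul_le_of_LLN {ω : ℤ → ℝ} {ℓ : ℝ}
    (hLLN : ∀ (α : ℝ) (β : ℤ),
      Tendsto (fun n : ℕ => ω ⌊α * n + β⌋ / n) atTop (𝓝 (α * ℓ)))
    {η : ℝ} (hη : 0 < η) : ∃ K, ∀ k : ℤ, |ω k - ℓ * k| ≤ η * |(k : ℝ)| + K := by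
  have hpos : Tendsto (fun n : ℕ => ω n / n) atTop (𝓝 ℓ) := by
    simpa using hLLN 1 0
  have hneg : Tendsto (fun n : ℕ => ω (-n) / n) atTop (𝓝 (-ℓ)) := by
    have h := hLLN (-1) 0
    simp only [neg_mul, one_mul, Int.cast_zero, add_zero] at h
    refine h.congr fun n => ?_
    rw [show (-(n : ℝ)) = ((-n : ℤ) : ℝ) by push_cast; rfl, Int.floor_intCast]
  obtain ⟨M, hM⟩ := eventually_atTop.1 ((Metric.tendsto_nhds.1 hpos η hη).and
    ((Metric.tendsto_nhds.1 hneg η hη).and (eventually_gt_atTop 0)))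
  refine ⟨∑ k ∈ Finset.Icc (-M : ℤ) M, |ω k - ℓ * k|, fun k => ?_⟩
  have hsum : 0 ≤ ∑ k ∈ Finset.Icc (-M : ℤ) M, |ω k - ℓ * k| :=
    Finset.sum_nonneg fun _ _ => abs_nonneg _
  by_cases hk : k ∈ Finset.Icc (-M : ℤ) M
  · have h1 := Finset.single_le_sum (f := fun k : ℤ => |ω k - ℓ * k|)
      (fun _ _ => abs_nonneg _) hk
    have h2 : 0 ≤ η * |(k : ℝ)| := by positivity
    linarith
  · obtain ⟨n, rfl | rfl⟩ := Int.eq_nat_or_neg k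
    · obtain ⟨h1, -, h3⟩ := hM n (by simp at hk; omega)
      have hn : (0 : ℝ) < n := by exact_mod_cast h3
      rw [Real.dist_eq] at h1
      have e : ω n - ℓ * (n : ℤ) = (ω n / n - ℓ) * n := by
        push_cast; field_simp
      rw [e, abs_mul]
      push_cast
      nlinarith [abs_nonneg (n : ℝ)]
    · obtain ⟨-, h1, h3⟩ := hM n (by simp at hk; omega)
      have hn : (0 : ℝ) < n := by exact_mod_cast h3
      rw [Real.dist_eq] at h1
      have e : ω (-n) - ℓ * (-n : ℤ) = (ω (-n) / n - -ℓ) * n := by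
        push_cast; field_simp
      rw [e, abs_mul]
      push_cast
      rw [abs_neg]
      nlinarith [abs_nonneg (n : ℝ)]

theorem norm_exp_mul_I_sub_exp_mul_I_le (x y : ℝ) :
    ‖Complex.exp (x * Complex.I) - Complex.exp (y * Complex.I)‖ ≤ |x - y| := by
  have e : Complex.exp (x * Complex.I) - Complex.exp (y * Complex.I)
      = Complex.exp (y * Complex.I) * (Complex.exp (Complex.I * (x - y : ℝ)) - 1) := by
    rw [mul_sub, ← Complex.exp_add, mul_one]; congr 2; push_cast; ring
  rw [e, norm_mul, Complex.norm_exp_ofReal_mul_I, one_mul]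
  exact Real.norm_exp_I_mul_ofReal_sub_one_le

namespace IsReinforcedWalk

variable {Ω : Type*} [MeasurableSpace Ω] {μ : Measure Ω} [IsProbabilityMeasure μ] {c : ℝ}
  {S : ℕ → Ω → ℤ}

theorem tendsto_integral_abs_sub_mul (h : IsReinforcedWalk μ c S) (hc : c < 1 / 2) {ω : ℤ → ℝ}
    {ℓ : ℝ} (hω : ∀ η > 0, ∃ K, ∀ k : ℤ, |ω k - ℓ * k| ≤ η * |(k : ℝ)| + K) :
    Tendsto (fun n : ℕ => ∫ a, |ω (S n a) - ℓ * S n a| / √n ∂μ) atTop (𝓝 0) := by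
  set B := 1 + max 1 (1 - 2 * c)⁻¹ with hB
  have hB0 : 0 < B := by positivity
  rw [Metric.tendsto_nhds]
  intro η hη
  obtain ⟨K, hK⟩ := hω (η / (2 * B)) (by positivity)
  have hlim : Tendsto (fun n : ℕ => K / √n) atTop (𝓝 0) :=
    Tendsto.const_div_atTop (Real.tendsto_sqrt_atTop.comp tendsto_natCast_atTop_atTop) K
  filter_upwards [hlim.eventually_lt_const (half_pos hη), eventually_gt_atTop 0] with n h1 hn
  have hn' : (0 : ℝ) < n := by exact_mod_cast hn
  have hs : 0 < √(n : ℝ) := Real.sqrt_pos.2 hn'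
  rw [Real.dist_eq, sub_zero, abs_of_nonneg (integral_nonneg fun a => by positivity)]
  have hpt : ∀ a, |ω (S n a) - ℓ * S n a| / √n
      ≤ η / (2 * B) * (1 + (S n a : ℝ) ^ 2 / n) + K / √n := by
    intro a
    have h2 : |(S n a : ℝ)| / √n ≤ 1 + (S n a : ℝ) ^ 2 / n := by
      have : (S n a : ℝ) ^ 2 / n = (|(S n a : ℝ)| / √n) ^ 2 := by
        rw [div_pow, sq_abs, Real.sq_sqrt hn'.le]
      rw [this]
      nlinarith [sq_nonneg (|(S n a : ℝ)| / √n - 1), sq_nonneg (|(S n a : ℝ)| / √n)]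
    calc |ω (S n a) - ℓ * S n a| / √n
        ≤ (η / (2 * B) * |(S n a : ℝ)| + K) / √n := by gcongr; exact hK _
      _ = η / (2 * B) * (|(S n a : ℝ)| / √n) + K / √n := by ring
      _ ≤ _ := by gcongr
  have hsq : (∫ a, (S n a : ℝ) ^ 2 ∂μ) / n ≤ B - 1 := by
    rw [div_le_iff₀ hn', hB, add_sub_cancel_left]; exact h.integral_sq_le hc n
  have i1 : Integrable (fun a => (S n a : ℝ) ^ 2 / n) μ :=
    h.integrable_comp n fun k => (k : ℝ) ^ 2 / n
  calc ∫ a, |ω (S n a) - ℓ * S n a| / √n ∂μ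
      ≤ ∫ a, (η / (2 * B) * (1 + (S n a : ℝ) ^ 2 / n) + K / √n) ∂μ :=
        integral_mono (h.integrable_comp n fun k => |ω k - ℓ * k| / √n)
          (h.integrable_comp n fun k : ℤ => η / (2 * B) * (1 + (k : ℝ) ^ 2 / n) + K / √n) hpt
    _ = η / (2 * B) * (1 + (∫ a, (S n a : ℝ) ^ 2 ∂μ) / n) + K / √n := by
        rw [integral_add (h.integrable_comp n fun k : ℤ => η / (2 * B) * (1 + (k : ℝ) ^ 2 / n))
            (integrable_const _),
          integral_const_mul, integral_add (integrable_const _) i1, integral_div]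
        simp
    _ ≤ η / (2 * B) * B + K / √n := by gcongr; linarith
    _ = η / 2 + K / √n := by field_simp
    _ < η := by linarith

theorem tendsto_charFun_comp (h : IsReinforcedWalk μ c S) (hc1 : |c| ≤ 1) (hc : c < 1 / 2)
    {ω : ℤ → ℝ} {ℓ : ℝ}
    (hω : ∀ η > 0, ∃ K, ∀ k : ℤ, |ω k - ℓ * k| ≤ η * |(k : ℝ)| + K) (t : ℝ) :
    Tendsto (fun n : ℕ => ∫ a, Complex.exp ((t * (ω (S n a) / √n) : ℝ) * Complex.I) ∂μ) atTop
      (𝓝 (Real.exp (-((t * ℓ) ^ 2 / 2 * (1 - 2 * c)⁻¹)) : ℝ)) := by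
  have h1 := h.tendsto_charFun hc1 hc (t * ℓ)
  have h2 := (h.tendsto_integral_abs_sub_mul hc hω).const_mul |t|
  rw [mul_zero] at h2
  have h3 : Tendsto (fun n : ℕ => ∫ a, Complex.exp ((t * (ω (S n a) / √n) : ℝ) * Complex.I) ∂μ
      - ∫ a, Complex.exp ((t * ℓ / √n * S n a : ℝ) * Complex.I) ∂μ) atTop (𝓝 0) := by
    refine squeeze_zero_norm (fun n => ?_) h2
    rw [← integral_sub
      (h.integrable_comp n fun k => Complex.exp ((t * (ω k / √n) : ℝ) * Complex.I))
      (h.integrable_comp n fun k : ℤ => Complex.exp ((t * ℓ / √n * k : ℝ) * Complex.I)),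
      ← integral_const_mul]
    refine norm_integral_le_of_norm_le
      (h.integrable_comp n fun k => |t| * (|ω k - ℓ * k| / √n)) (ae_of_all _ fun a => ?_)
    refine (norm_exp_mul_I_sub_exp_mul_I_le _ _).trans_eq ?_
    have e : t * (ω (S n a) / √n) - t * ℓ / √n * S n a
        = t * ((ω (S n a) - ℓ * S n a) / √n) := by ring
    rw [e, abs_mul, abs_div, abs_of_nonneg (Real.sqrt_nonneg _)]
  simpa using h3.add h1

end IsReinforcedWalk

theorem isReinforcedWalk_of_condExp
    {Ω : Type*} [mΩ : MeasurableSpace Ω] {μ : Measure Ω} [IsProbabilityMeasure μ] {c : ℝ}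
    {V : ℕ → Ω → ℤ} (hVmeas : ∀ n, Measurable (V n))
    (hVval : ∀ n a, 1 ≤ n → V n a = 1 ∨ V n a = -1)
    (hV1 : μ {a | V 1 a = 1} = 1 / 2)
    {S : ℕ → Ω → ℤ} (hS : ∀ n a, S n a = ∑ k ∈ Finset.range n, V (k + 1) a)
    (hcond : ∀ n : ℕ, 1 ≤ n →
      μ[({a | V (n + 1) a = 1}).indicator (fun _ => (1 : ℝ)) |
          ⨆ k ∈ Set.Icc 1 n, MeasurableSpace.comap (V k) inferInstance]
        =ᵐ[μ] fun a => 1 / 2 + c * (S n a : ℝ) / (2 * n)) :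
    IsReinforcedWalk μ c S := by
  have hmeas : ∀ n, Measurable (S n) := fun n => by
    rw [funext (hS n)]; exact Finset.measurable_fun_sum _ fun k _ => hVmeas (k + 1)
  have hzero : ∀ a, S 0 a = 0 := fun a => by simp [hS]
  have hsucc : ∀ n a, S (n + 1) a = S n a + V (n + 1) a := fun n a => by
    rw [hS, hS, Finset.sum_range_succ]
  have habs : ∀ n a, |S n a| ≤ n := by
    intro n a
    induction n with
    | zero => simp [hzero]
    | succ n ih =>
      rw [hsucc]
      refine (abs_add_le _ _).trans ?_
      have : |V (n + 1) a| = 1 := by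
        rcases hVval (n + 1) a (by omega) with h | h <;> simp [h]
      push_cast
      linarith
  refine ⟨hmeas, hzero, habs, fun n f => ?_⟩
  set A : Set Ω := {a | V (n + 1) a = 1} with hA
  have hAm : MeasurableSet A := hVmeas (n + 1) (measurableSet_singleton 1)
  set X : Ω → ℝ := A.indicator (fun _ => (1 : ℝ)) with hXdef
  have hXi : Integrable X μ := (integrable_const 1).indicator hAm
  have hint : ∀ g : ℤ → ℂ, Integrable (fun a => g (S n a)) μ := fun g =>
    integrable_comp_of_abs_le (hmeas n) (habs n) g
  set g : Ω → ℂ := fun a => f (S n a + 1) - f (S n a - 1) with hg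
  have hgi : Integrable g μ := hint fun k => f (k + 1) - f (k - 1)
  have hdecomp : ∀ a, f (S (n + 1) a) = f (S n a - 1) + (X • g) a := by
    intro a
    rw [hsucc]
    rcases hVval (n + 1) a (by omega) with h | h
    · have : a ∈ A := h
      simp [hXdef, this, hg, h]
    · have : a ∉ A := by simp [hA, h]
      simp [hXdef, this, h, sub_eq_add_neg]
  have hXg : Integrable (X • g) μ := by
    have : X • g = A.indicator g := by
      ext a; by_cases ha : a ∈ A <;> simp [hXdef, ha]
    rw [this]; exact hgi.indicator hAm
  have hmain : ∫ a, (X • g) a ∂μ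
      = ∫ a, ((1 / 2 + c * (S n a : ℝ) / (2 * n) : ℝ) : ℂ) * g a ∂μ := by
    rcases Nat.eq_zero_or_pos n with rfl | hn
    · have e : ∀ a, (X • g) a = A.indicator (fun _ => f 1 - f (-1)) a := by
        intro a; by_cases ha : a ∈ A <;> simp [hXdef, ha, hg, hzero]
      simp_rw [e]
      rw [integral_indicator hAm]
      simp [hg, hzero, Measure.real, hA, hV1]
    · set m : MeasurableSpace Ω :=
        ⨆ k ∈ Set.Icc 1 n, MeasurableSpace.comap (V k) inferInstance with hmdef
      have hm : m ≤ mΩ := iSup₂_le fun k _ => (hVmeas k).comap_le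
      have hSm : Measurable[m] (S n) := by
        rw [funext (hS n)]
        refine Finset.measurable_fun_sum _ fun k hk => ?_
        refine Measurable.mono (comap_measurable (V (k + 1))) ?_ le_rfl
        exact le_iSup₂_of_le (k + 1) ⟨by omega, by simpa using hk⟩ le_rfl
      have hgm : StronglyMeasurable[m] g :=
        (StronglyMeasurable.of_discrete
          (f := fun k : ℤ => f (k + 1) - f (k - 1))).comp_measurable hSm
      have h1 := condExp_smul_of_aestronglyMeasurable_right (m := m) hXi hXg
        hgm.aestronglyMeasurable
      rw [← integral_condExp hm]
      refine integral_congr_ae ?_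
      filter_upwards [h1, hcond n hn] with a h2 h3
      rw [h2, Pi.smul_apply', h3, Complex.real_smul]
  have hcoef : Integrable
      (fun a => ((1 / 2 + c * (S n a : ℝ) / (2 * n) : ℝ) : ℂ) * g a) μ :=
    hint fun k => ((1 / 2 + c * (k : ℝ) / (2 * n) : ℝ) : ℂ) * (f (k + 1) - f (k - 1))
  simp_rw [hdecomp]
  rw [integral_add (hint fun k => f (k - 1)) hXg, hmain,
    ← integral_add (hint fun k => f (k - 1)) hcoef]
  refine integral_congr_ae (ae_of_all _ fun a => ?_)
  simp only [hg]
  push_cast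
  ring

theorem tendsto_measure_le_of_tendsto_charFun
    {Ω : Type*} [MeasurableSpace Ω] {μ : Measure Ω} [IsProbabilityMeasure μ] {Y : ℕ → Ω → ℝ}
    (hY : ∀ n, Measurable (Y n)) {ν : Measure ℝ} [IsProbabilityMeasure ν] [NullSingletonClass ν]
    (h : ∀ t : ℝ, Tendsto (fun n => ∫ a, Complex.exp ((t * Y n a : ℝ) * Complex.I) ∂μ) atTop
      (𝓝 (charFun ν t))) (x : ℝ) :
    Tendsto (fun n => (μ {a | Y n a ≤ x}).toReal) atTop (𝓝 (ν (Set.Iic x)).toReal) := by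
  let P : ℕ → ProbabilityMeasure ℝ := fun n =>
    ⟨μ.map (Y n), Measure.isProbabilityMeasure_map (hY n).aemeasurable⟩
  let Q : ProbabilityMeasure ℝ := ⟨ν, inferInstance⟩
  have hPQ : Tendsto P atTop (𝓝 Q) := by
    refine ProbabilityMeasure.tendsto_of_tendsto_charFun fun t => (h t).congr fun n => ?_
    change _ = charFun (μ.map (Y n)) t
    rw [charFun_apply_real, integral_map (hY n).aemeasurable
      (by fun_prop : Continuous _).aestronglyMeasurable]
    simp
  have h1 := ProbabilityMeasure.tendsto_measure_of_null_frontier_of_tendsto' hPQ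
    (E := Set.Iic x) (by rw [frontier_Iic]; exact measure_singleton (μ := ν) x)
  refine ((ENNReal.tendsto_toReal (measure_ne_top ν _)).comp h1).congr fun n => ?_
  change (μ.map (Y n) (Set.Iic x)).toReal = _
  rw [Measure.map_apply (hY n) measurableSet_Iic]
  rfl

/-- Theorem 2.3, discrete-time part: quenched CLT for the step-reinforced Lévy–Lorentz gas.
For `0 ≤ p < 3/4`, `X^{(p)}_n/√n` converges in distribution to `N(0, ℓ²(3 − 4p)⁻¹)`,
stated via convergence of CDFs. -/
theorem reinforced_levy_lorentz_discrete_CLT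
    {Ω : Type*} [MeasurableSpace Ω] (μ : Measure Ω) [IsProbabilityMeasure μ]
    -- scatterers
    (ω : ℤ → ℝ) (hmono : StrictMono ω) (hω0 : ω 0 = 0)
    (ℓ : ℝ) (hℓ : 0 < ℓ)
    (hLLN : ∀ (α : ℝ) (β : ℤ),
      Tendsto (fun n : ℕ => ω ⌊α * n + β⌋ / n) atTop (𝓝 (α * ℓ)))
    -- step-reinforced walk with memory parameter p
    (p : ℝ) (hp0 : 0 ≤ p) (hp34 : p < 3 / 4)
    (V : ℕ → Ω → ℤ) (hVmeas : ∀ n, Measurable (V n))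
    (hVval : ∀ n a, 1 ≤ n → V n a = 1 ∨ V n a = -1)
    (hV1 : μ {a | V 1 a = 1} = 1 / 2)
    (S : ℕ → Ω → ℤ) (hS : ∀ n a, S n a = ∑ k ∈ Finset.range n, V (k + 1) a)
    (hcond : ∀ n : ℕ, 1 ≤ n →
      μ[({a | V (n + 1) a = 1}).indicator (fun _ => (1 : ℝ)) |
          ⨆ k ∈ Set.Icc 1 n, MeasurableSpace.comap (V k) inferInstance]
        =ᵐ[μ] fun a => 1 / 2 + (2 * p - 1) * (S n a : ℝ) / (2 * n))
    -- the step-reinforced Lévy–Lorentz gas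
    (X : ℕ → Ω → ℝ) (hX : ∀ n a, X n a = ω (S n a)) :
    ∀ x : ℝ,
      Tendsto (fun n : ℕ => (μ {a | X n a / Real.sqrt n ≤ x}).toReal) atTop
        (𝓝 ((gaussianReal 0 (Real.toNNReal (ℓ ^ 2 * (3 - 4 * p)⁻¹))
            (Set.Iic x)).toReal)) := by
  have hc1 : |2 * p - 1| ≤ 1 := by rw [abs_le]; constructor <;> linarith
  have hc : 2 * p - 1 < 1 / 2 := by linarith
  have hwalk : IsReinforcedWalk μ (2 * p - 1) S :=
    isReinforcedWalk_of_condExp hVmeas hVval hV1 hS hcond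
  have hvar : 0 < ℓ ^ 2 * (3 - 4 * p)⁻¹ := by
    have : 0 < 3 - 4 * p := by linarith
    positivity
  have : NullSingletonClass (gaussianReal 0 (Real.toNNReal (ℓ ^ 2 * (3 - 4 * p)⁻¹))) :=
    nullSingletonClass_gaussianReal (Real.toNNReal_pos.2 hvar).ne'
  simp_rw [hX]
  refine tendsto_measure_le_of_tendsto_charFun (Y := fun n a => ω (S n a) / √n)
    (fun n => (measurable_from_top.comp (hwalk.measurable n)).div_const _) fun t => ?_
  have h := hwalk.tendsto_charFun_comp hc1 hc
    (fun η hη => exists_abs_sub_mul_le_of_LLN hLLN hη) t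
  convert h using 2
  rw [charFun_gaussianReal, Real.coe_toNNReal _ hvar.le, Complex.ofReal_exp]
  congr 1
  push_cast
  ring
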